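/- (Corollary 2.3, arithmetic genus is 1.) With F, n, n_1, n_2, Z', I as in the context, there exists a polynomial p ∈ ℚ[k] such that p(k) = dim_F(Z'_k/(I ∩ Z'_k)) for all sufficiently large k (the Hilbert polynomial of the quotient ring), and its constant term satisfies p(0) = 1. -/

import Mathlib

open MvPolynomial in
/-- The ideal `I` of `F[z_{i,j} : 1 ≤ i ≤ n-n₁, 1 ≤ j ≤ n₂]` generated by
(a) the variables `z_{i,j}` with `1 ≤ i ≤ n₂-n₁`, `n₁+1 ≤ j ≤ n₂`;
(b) the 2×2 minors with rows in `[1, n₂-n₁]` and columns in `[1, n₁]`;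
(c) the 2×2 minors with rows in `[n₂-n₁+1, n-n₁]` and columns in `[n₁+1, n₂]`;
(d) all 3×3 minors.  (Indices of `Fin` are 0-based, so `i : Fin (n-n₁)` represents
the row `i+1`, and similarly for columns.) -/
noncomputable def detIdeal (F : Type*) [Field F] (n n₁ n₂ : ℕ) :
    Ideal (MvPolynomial (Fin (n - n₁) × Fin n₂) F) :=
  Ideal.span
    ({ p | ∃ i : Fin (n - n₁), ∃ j : Fin n₂,
        (i : ℕ) < n₂ - n₁ ∧ n₁ ≤ (j : ℕ) ∧ p = X (i, j) } ∪
     { p | ∃ i i' : Fin (n - n₁), ∃ j j' : Fin n₂,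
        i < i' ∧ (i' : ℕ) < n₂ - n₁ ∧ j < j' ∧ (j' : ℕ) < n₁ ∧
        p = X (i, j) * X (i', j') - X (i, j') * X (i', j) } ∪
     { p | ∃ i i' : Fin (n - n₁), ∃ j j' : Fin n₂,
        n₂ - n₁ ≤ (i : ℕ) ∧ i < i' ∧ n₁ ≤ (j : ℕ) ∧ j < j' ∧
        p = X (i, j) * X (i', j') - X (i, j') * X (i', j) } ∪
     { p | ∃ i₁ i₂ i₃ : Fin (n - n₁), ∃ j₁ j₂ j₃ : Fin n₂,
        i₁ < i₂ ∧ i₂ < i₃ ∧ j₁ < j₂ ∧ j₂ < j₃ ∧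
        p = X (i₁, j₁) * X (i₂, j₂) * X (i₃, j₃)
            + X (i₂, j₁) * X (i₃, j₂) * X (i₁, j₃)
            + X (i₃, j₁) * X (i₁, j₂) * X (i₂, j₃)
            - X (i₂, j₁) * X (i₁, j₂) * X (i₃, j₃)
            - X (i₁, j₁) * X (i₃, j₂) * X (i₂, j₃)
            - X (i₃, j₁) * X (i₂, j₂) * X (i₁, j₃) })

/-- `hilbFn F n n₁ n₂ k` is `dim_F (Z'_k / (I ∩ Z'_k))`, the Hilbert function of the
homogeneous coordinate ring of the variety determined by `detIdeal F n n₁ n₂`. -/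
noncomputable def hilbFn (F : Type*) [Field F] (n n₁ n₂ k : ℕ) : ℕ :=
  Module.finrank F
    ((MvPolynomial.homogeneousSubmodule (Fin (n - n₁) × Fin n₂) F k) ⧸
      (Submodule.comap
        (MvPolynomial.homogeneousSubmodule (Fin (n - n₁) × Fin n₂) F k).subtype
        (Submodule.restrictScalars F (detIdeal F n n₁ n₂))))

section TailSums

variable {N M : ℕ}

/-- The sum of the entries of `p` in rows of index at least `x` and columns of index at
least `y`. -/
def tailSum (p : Fin N × Fin M → ℕ) (x y : ℕ) : ℕ :=
  ∑ z, if x ≤ (z.1 : ℕ) ∧ y ≤ (z.2 : ℕ) then p z else 0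

theorem tailSum_add (p q : Fin N × Fin M → ℕ) (x y : ℕ) :
    tailSum (p + q) x y = tailSum p x y + tailSum q x y := by
  simp only [tailSum, ← Finset.sum_add_distrib]
  refine Finset.sum_congr rfl fun z _ => ?_
  split_ifs <;> simp

theorem tailSum_injective : Function.Injective (tailSum (N := N) (M := M)) := by
  have key : ∀ (p : Fin N × Fin M → ℕ) (z : Fin N × Fin M),
      tailSum p z.1 z.2 + tailSum p (z.1 + 1) (z.2 + 1) =
        tailSum p (z.1 + 1) z.2 + tailSum p z.1 (z.2 + 1) + p z := by
    intro p z
    have hz : p z = ∑ w, if w = z then p w else 0 := by simp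
    rw [hz]
    simp only [tailSum, ← Finset.sum_add_distrib]
    refine Finset.sum_congr rfl fun w _ => ?_
    have : w = z ↔ (w.1 : ℕ) = z.1 ∧ (w.2 : ℕ) = z.2 := by
      rw [Prod.ext_iff, Fin.ext_iff, Fin.ext_iff]
    simp only [this]
    split_ifs <;> omega
  intro p q h
  funext z
  have h1 := key p z
  have h2 := key q z
  rw [h] at h1
  omega

theorem tailSum_le_of_antichain {p q : Fin N × Fin M → ℕ}
    (hp : ∀ z w, p z ≠ 0 → p w ≠ 0 → z.1 < w.1 → z.2 < w.2 → False)
    (hrow : ∀ x, tailSum p x 0 = tailSum q x 0) (hcol : ∀ y, tailSum p 0 y = tailSum q 0 y)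
    (x y : ℕ) : tailSum p x y ≤ tailSum q x y := by
  by_cases h : ∃ w : Fin N × Fin M, p w ≠ 0 ∧ x ≤ (w.1 : ℕ) ∧ y ≤ (w.2 : ℕ)
  · obtain ⟨w, hw, hwx, hwy⟩ := h
    have h1 : tailSum p x y + tailSum p 0 0 = tailSum p x 0 + tailSum p 0 y := by
      simp only [tailSum, ← Finset.sum_add_distrib]
      refine Finset.sum_congr rfl fun z _ => ?_
      by_cases hz : p z = 0
      · simp [hz]
      have : x ≤ (z.1 : ℕ) ∨ y ≤ (z.2 : ℕ) := by
        by_contra! hcon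
        exact hp z w hz hw (Fin.lt_def.2 (by omega)) (Fin.lt_def.2 (by omega))
      split_ifs <;> omega
    have h2 : tailSum q x 0 + tailSum q 0 y ≤ tailSum q x y + tailSum q 0 0 := by
      simp only [tailSum, ← Finset.sum_add_distrib]
      refine Finset.sum_le_sum fun z _ => ?_
      split_ifs <;> omega
    have h3 := hrow x
    have h4 := hcol y
    have h5 := hrow 0
    omega
  · have : tailSum p x y = 0 := by
      refine Finset.sum_eq_zero fun z _ => ?_
      split_ifs with hz
      · by_contra hne
        exact h ⟨z, hne, hz⟩
      · rfl
    omega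

/-- The exponent vector recording all row tails and column tails of `p`. -/
def margins (p : Fin N × Fin M → ℕ) : (ℕ → ℕ) × (ℕ → ℕ) :=
  (fun x => tailSum p x 0, fun y => tailSum p 0 y)

theorem sum_nsmul_margins (p : Fin N × Fin M → ℕ) :
    ∑ z, p z • ((fun x => if x ≤ (z.1 : ℕ) then 1 else 0, fun y => if y ≤ (z.2 : ℕ) then 1 else 0) :
      (ℕ → ℕ) × (ℕ → ℕ)) = margins p := by
  ext x <;> simp [margins, tailSum, Prod.fst_sum, Prod.snd_sum]

end TailSums

section Parametrization

variable (F : Type*) [Field F] (N M a c : ℕ)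

/-- The coordinates of the product `p vᵀ + w qᵀ`, where `v` is supported on the first `c` columns
and `w` vanishes on the first `a` rows; the variables are products of successive ratios, so that
exponents record tails of the margins. -/
noncomputable def parametrization :
    MvPolynomial (Fin N × Fin M) F →ₐ[F]
      AddMonoidAlgebra F (((ℕ → ℕ) × (ℕ → ℕ)) × ((ℕ → ℕ) × (ℕ → ℕ))) :=
  MvPolynomial.aeval fun z =>
    AddMonoidAlgebra.single ((fun x => if x ≤ (z.1 : ℕ) then 1 else 0,
      fun y => if y ≤ (z.2 : ℕ) then 1 else 0), 0) (if (z.2 : ℕ) < c then 1 else 0) +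
    AddMonoidAlgebra.single (0, (fun x => if x ≤ (z.1 : ℕ) then 1 else 0,
      fun y => if y ≤ (z.2 : ℕ) then 1 else 0)) (if a ≤ (z.1 : ℕ) then 1 else 0)

theorem exists_parametrization_X :
    ∃ (P W : Fin N → AddMonoidAlgebra F (((ℕ → ℕ) × (ℕ → ℕ)) × ((ℕ → ℕ) × (ℕ → ℕ))))
      (V Q : Fin M → AddMonoidAlgebra F (((ℕ → ℕ) × (ℕ → ℕ)) × ((ℕ → ℕ) × (ℕ → ℕ)))),
      (∀ i j, parametrization F N M a c (MvPolynomial.X (i, j)) = P i * V j + W i * Q j) ∧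
      (∀ i : Fin N, (i : ℕ) < a → W i = 0) ∧ (∀ j : Fin M, c ≤ (j : ℕ) → V j = 0) := by
  refine ⟨fun i => .single ((fun x => if x ≤ (i : ℕ) then 1 else 0, 0), 0) 1,
    fun i => .single (0, (fun x => if x ≤ (i : ℕ) then 1 else 0, 0)) (if a ≤ (i : ℕ) then 1 else 0),
    fun j => .single ((0, fun y => if y ≤ (j : ℕ) then 1 else 0), 0) (if (j : ℕ) < c then 1 else 0),
    fun j => .single (0, (0, fun y => if y ≤ (j : ℕ) then 1 else 0)) 1, ?_, ?_, ?_⟩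
  · intro i j
    simp [parametrization, AddMonoidAlgebra.single_mul_single]
  · intro i hi
    simp [Nat.not_le.2 hi]
  · intro j hj
    simp [Nat.not_lt.2 hj]

variable {N M a c}

theorem prod_single_pow {σ G : Type*} [AddCommMonoid G] (s : Finset σ) (g : σ → G) (r : σ → F)
    (k : σ → ℕ) :
    ∏ z ∈ s, AddMonoidAlgebra.single (g z) (r z) ^ k z =
      AddMonoidAlgebra.single (∑ z ∈ s, k z • g z) (∏ z ∈ s, r z ^ k z) := by
  classical
  induction s using Finset.induction_on with
  | empty => simp [AddMonoidAlgebra.one_def]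
  | insert z s hz ih =>
    rw [Finset.prod_insert hz, Finset.sum_insert hz, Finset.prod_insert hz, ih,
      AddMonoidAlgebra.single_pow, AddMonoidAlgebra.single_mul_single]

theorem parametrization_monomial (m : Fin N × Fin M →₀ ℕ) (r : F) :
    parametrization F N M a c (MvPolynomial.monomial m r) =
      ∑ p ∈ Fintype.piFinset fun z => Finset.range (m z + 1),
        AddMonoidAlgebra.single (margins p, margins fun z => m z - p z)
          (r * ((∏ z, (if (z.2 : ℕ) < c then 1 else 0) ^ p z) *
            (∏ z, (if a ≤ (z.1 : ℕ) then 1 else 0) ^ (m z - p z)) *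
            ∏ z, ((m z).choose (p z) : F))) := by
  rw [parametrization, MvPolynomial.aeval_monomial, Finsupp.prod_fintype _ _ (by simp)]
  simp_rw [add_pow]
  rw [Finset.prod_univ_sum, Finset.mul_sum]
  refine Finset.sum_congr rfl fun p _ => ?_
  rw [Finset.prod_mul_distrib, Finset.prod_mul_distrib, prod_single_pow, prod_single_pow,
    AddMonoidAlgebra.single_mul_single]
  have hc : ∏ z, ((m z).choose (p z) : AddMonoidAlgebra F (((ℕ → ℕ) × (ℕ → ℕ)) × ((ℕ → ℕ) × (ℕ → ℕ))))
      = algebraMap F _ (∏ z, ((m z).choose (p z) : F)) := by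
    simp
  rw [hc, mul_comm (AddMonoidAlgebra.single _ _), ← Algebra.smul_def, ← Algebra.smul_def,
    AddMonoidAlgebra.smul_single, AddMonoidAlgebra.smul_single]
  congr 1
  · simp [← sum_nsmul_margins, Prod.ext_iff, Prod.fst_sum, Prod.snd_sum]
  · simp only [smul_eq_mul]
    ring

end Parametrization

section Standard

variable {N M : ℕ}

/-- A set of positions is standard if it contains no position of the zero block, no strictly
increasing pair in the first `a` rows or outside of the first `c` columns, and no strictly
increasing triple. -/
def IsStandard (a c : ℕ) (T : Finset (Fin N × Fin M)) : Prop :=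
  (∀ x ∈ T, (x.1 : ℕ) < a → (x.2 : ℕ) < c) ∧
  (∀ x ∈ T, ∀ y ∈ T, x.1 < y.1 → x.2 < y.2 → a ≤ (y.1 : ℕ) ∧ (x.2 : ℕ) < c) ∧
  (∀ x ∈ T, ∀ y ∈ T, ∀ z ∈ T, x.1 < y.1 → x.2 < y.2 → y.1 < z.1 → y.2 < z.2 → False)

theorem IsStandard.exists_split {a c : ℕ} {T : Finset (Fin N × Fin M)} (hT : IsStandard a c T) :
    ∃ S : Set (Fin N × Fin M), (∀ x ∈ T, x ∈ S → (x.2 : ℕ) < c) ∧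
      (∀ x ∈ T, x ∉ S → a ≤ (x.1 : ℕ)) ∧
      (∀ x ∈ T, ∀ y ∈ T, x ∈ S → y ∈ S → x.1 < y.1 → x.2 < y.2 → False) ∧
      (∀ x ∈ T, ∀ y ∈ T, x ∉ S → y ∉ S → x.1 < y.1 → x.2 < y.2 → False) := by
  obtain ⟨h1, h2, h3⟩ := hT
  refine ⟨{x | (x.2 : ℕ) < c ∧ ∀ w ∈ T, w.1 < x.1 → w.2 < x.2 → False}, fun x _ hx => hx.1,
    fun x hx hxS => ?_, fun x hx y _ _ hyS hxy hxy' => hyS.2 x hx hxy hxy',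
    fun x hx y hy hxS _ hxy hxy' => ?_⟩
  · by_contra! ha
    exact hxS ⟨h1 x hx ha, fun w hw hwx hwx' => absurd (h2 w hw x hx hwx hwx').1 (by omega)⟩
  · exact hxS ⟨(h2 x hx y hy hxy hxy').2, fun w hw hwx hwx' => h3 w hw x hx y hy hwx hwx' hxy hxy'⟩

theorem eq_zero_of_parametrization_eq_zero {F : Type*} [Field F] {a c : ℕ}
    {f : MvPolynomial (Fin N × Fin M) F} (hf : parametrization F N M a c f = 0)
    (hstd : ∀ m ∈ f.support, IsStandard a c m.support) : f = 0 := by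
  classical
  by_contra hne
  obtain ⟨m, hm, hmax⟩ := f.support.exists_maximalFor
    (fun m : Fin N × Fin M →₀ ℕ => tailSum m) (Finset.nonempty_iff_ne_empty.2 (by simpa using hne))
  obtain ⟨S, hS1, hS2, hS3, hS4⟩ := (hstd m hm).exists_split
  set p₀ : Fin N × Fin M → ℕ := fun z => if z ∈ S then m z else 0 with hp₀
  set q₀ : Fin N × Fin M → ℕ := fun z => m z - p₀ z with hq₀
  have hp₀S : ∀ z, p₀ z ≠ 0 → z ∈ m.support ∧ z ∈ S := by
    intro z hz
    by_cases hzS : z ∈ S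
    · exact ⟨by simpa [hp₀, hzS] using hz, hzS⟩
    · exact absurd (if_neg hzS) hz
  have hq₀S : ∀ z, q₀ z ≠ 0 → z ∈ m.support ∧ z ∉ S := by
    intro z hz
    by_cases hzS : z ∈ S
    · exact absurd (by simp [hq₀, hp₀, hzS]) hz
    · exact ⟨by simpa [hq₀, hp₀, hzS] using hz, hzS⟩
  have hadd : p₀ + q₀ = m := by
    funext z
    by_cases hzS : z ∈ S <;> simp [hp₀, hq₀, hzS]
  have key : ∀ m' ∈ f.support, ∀ p ∈ Fintype.piFinset (fun z => Finset.range (m' z + 1)),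
      (margins p, margins fun z => m' z - p z) = (margins p₀, margins q₀) → m' = m ∧ p = p₀ := by
    intro m' hm' p hp heq
    obtain ⟨heqp, heqq⟩ := Prod.mk.inj heq
    set q : Fin N × Fin M → ℕ := fun z => m' z - p z with hq
    have hpq : p + q = m' := by
      funext z
      have := Fintype.mem_piFinset.1 hp z
      simp only [Finset.mem_range] at this
      simp only [hq, Pi.add_apply]
      omega
    have hlep : ∀ x y, tailSum p₀ x y ≤ tailSum p x y :=
      tailSum_le_of_antichain (fun z w hz hw => hS3 z (hp₀S z hz).1 w (hp₀S w hw).1 (hp₀S z hz).2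
        (hp₀S w hw).2) (fun x => (congrFun (congrArg Prod.fst heqp) x).symm)
        (fun y => (congrFun (congrArg Prod.snd heqp) y).symm)
    have hleq : ∀ x y, tailSum q₀ x y ≤ tailSum q x y :=
      tailSum_le_of_antichain (fun z w hz hw => hS4 z (hq₀S z hz).1 w (hq₀S w hw).1 (hq₀S z hz).2
        (hq₀S w hw).2) (fun x => (congrFun (congrArg Prod.fst heqq) x).symm)
        (fun y => (congrFun (congrArg Prod.snd heqq) y).symm)
    have hge : tailSum m' ≤ tailSum m := hmax hm' (by
      intro x y
      simp only [← hpq, ← hadd, tailSum_add]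
      exact add_le_add (hlep x y) (hleq x y))
    have hp : p = p₀ := tailSum_injective <| by
      funext x y
      have h1 : tailSum m' x y ≤ tailSum m x y := hge x y
      rw [← hpq, ← hadd, tailSum_add, tailSum_add] at h1
      have h2 := hlep x y
      have h3 := hleq x y
      omega
    have hq : q = q₀ := tailSum_injective <| by
      funext x y
      have h1 : tailSum m' x y ≤ tailSum m x y := hge x y
      rw [← hpq, ← hadd, tailSum_add, tailSum_add] at h1
      have h2 := hlep x y
      have h3 := hleq x y
      omega
    refine ⟨DFunLike.coe_injective ?_, hp⟩
    rw [← hpq, ← hadd, hp, hq]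
  have hp₀mem : p₀ ∈ Fintype.piFinset (fun z => Finset.range (m z + 1)) := by
    simp only [Fintype.mem_piFinset, Finset.mem_range]
    intro z
    simp only [hp₀]
    split_ifs <;> omega
  have hcoeff : (parametrization F N M a c f).coeff (margins p₀, margins q₀) =
      MvPolynomial.coeff m f := by
    conv_lhs => rw [f.as_sum]
    rw [map_sum, AddMonoidAlgebra.coeff_sum, Finsupp.finsetSum_apply, Finset.sum_eq_single m]
    · rw [parametrization_monomial, AddMonoidAlgebra.coeff_sum, Finsupp.finsetSum_apply,
        Finset.sum_eq_single p₀]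
      · rw [AddMonoidAlgebra.coeff_single, Finsupp.single_eq_same]
        rw [Finset.prod_eq_one, Finset.prod_eq_one, Finset.prod_eq_one]
        · simp
        · intro z _
          simp only [hp₀]
          split_ifs <;> simp
        · intro z _
          by_cases hz : q₀ z = 0
          · exact (congrArg _ hz).trans (pow_zero _)
          · rw [if_pos (hS2 z (hq₀S z hz).1 (hq₀S z hz).2), one_pow]
        · intro z _
          by_cases hz : p₀ z = 0
          · rw [hz, pow_zero]
          · rw [if_pos (hS1 z (hp₀S z hz).1 (hp₀S z hz).2), one_pow]
      · intro p hp hpne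
        rw [AddMonoidAlgebra.coeff_single]
        exact Finsupp.single_eq_of_ne fun h => hpne (key m hm p hp h.symm).2
      · exact fun h => absurd hp₀mem h
    · intro m' hm' hne'
      rw [parametrization_monomial, AddMonoidAlgebra.coeff_sum, Finsupp.finsetSum_apply]
      refine Finset.sum_eq_zero fun p hp => ?_
      rw [AddMonoidAlgebra.coeff_single]
      exact Finsupp.single_eq_of_ne fun h => hne' (key m' hm' p hp h.symm).1
    · exact fun h => absurd hm h
  rw [hf] at hcoeff
  exact MvPolynomial.mem_support_iff.1 hm (hcoeff.symm.trans (by simp))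

end Standard

section Hilbert

variable {n n₁ n₂ : ℕ}

theorem detIdeal_le_ker (F : Type*) [Field F] :
    detIdeal F n n₁ n₂ ≤
      RingHom.ker (parametrization F (n - n₁) n₂ (n₂ - n₁) n₁) := by
  obtain ⟨P, W, V, Q, hX, hW, hV⟩ := exists_parametrization_X F (n - n₁) n₂ (n₂ - n₁) n₁
  refine Ideal.span_le.2 ?_
  rintro p (((⟨i, j, hi, hj, rfl⟩ | ⟨i, i', j, j', hii, hi', hjj, hj', rfl⟩) |
    ⟨i, i', j, j', hi, hii, hj, hjj, rfl⟩) | ⟨i₁, i₂, i₃, j₁, j₂, j₃, -, -, -, -, rfl⟩) <;>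
  simp only [SetLike.mem_coe, RingHom.mem_ker, map_add, map_sub, map_mul, hX]
  · rw [hW i hi, hV j hj]
    ring
  · rw [hW i (lt_trans hii hi'), hW i' hi']
    ring
  · rw [hV j hj, hV j' (hj.trans hjj.le)]
    ring
  · ring

/-- The exponents of degree `k` with standard support. -/
abbrev StandardExponent (N M a c k : ℕ) : Type :=
  {m : Fin N × Fin M →₀ ℕ // m.degree = k ∧ IsStandard a c m.support}

open MvPolynomial in
theorem monomial_mem_span_sup_detIdeal {F : Type*} [Field F] {k : ℕ}
    {m : Fin (n - n₁) × Fin n₂ →₀ ℕ} (hm : m.degree = k) :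
    (monomial m 1 : MvPolynomial (Fin (n - n₁) × Fin n₂) F) ∈
      Submodule.span F (Set.range fun m : StandardExponent (n - n₁) n₂ (n₂ - n₁) n₁ k =>
        (monomial m.1 1 : MvPolynomial (Fin (n - n₁) × Fin n₂) F)) ⊔
      (detIdeal F n n₁ n₂).restrictScalars F := by
  classical
  set L := Submodule.span F (Set.range fun m : StandardExponent (n - n₁) n₂ (n₂ - n₁) n₁ k =>
        (monomial m.1 1 : MvPolynomial (Fin (n - n₁) × Fin n₂) F)) ⊔
      (detIdeal F n n₁ n₂).restrictScalars F with hL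
  have hI : ∀ f ∈ detIdeal F n n₁ n₂, f ∈ L := fun f hf => Submodule.mem_sup_right hf
  have hgen : ∀ m₀, ∀ f ∈ detIdeal F n n₁ n₂, monomial m₀ 1 * f ∈ L :=
    fun m₀ f hf => hI _ (Ideal.mul_mem_left _ _ hf)
  induction hs : Finsupp.weight (fun z : Fin (n - n₁) × Fin n₂ => (z.1 : ℕ) * z.2) m
    using Nat.strong_induction_on generalizing m with
  | _ s ih =>
  have hstep : ∀ m' : Fin (n - n₁) × Fin n₂ →₀ ℕ, m'.degree = k →
      Finsupp.weight (fun z : Fin (n - n₁) × Fin n₂ => (z.1 : ℕ) * z.2) m' < s →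
      monomial m' 1 ∈ L := fun m' h1 h2 => ih _ h2 h1 rfl
  subst hs
  by_cases hstd : IsStandard (n₂ - n₁) n₁ m.support
  · exact Submodule.mem_sup_left (Submodule.subset_span ⟨⟨m, hm, hstd⟩, rfl⟩)
  have hle : ∀ x ∈ m.support, Finsupp.single x 1 ≤ m := by
    intro x hx
    simpa [Finsupp.single_le_iff, Nat.one_le_iff_ne_zero] using hx
  have hpair : ∀ x ∈ m.support, ∀ y ∈ m.support, x.1 < y.1 → x.2 < y.2 →
      (X x * X y - X (x.1, y.2) * X (y.1, x.2) : MvPolynomial _ F) ∈ detIdeal F n n₁ n₂ →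
      monomial m 1 ∈ L := by
    rintro ⟨i, j⟩ hx ⟨i', j'⟩ hy hi hj hmem
    obtain ⟨m₀, rfl⟩ : ∃ m₀, m = m₀ + Finsupp.single (i, j) 1 + Finsupp.single (i', j') 1 := by
      refine ⟨m - Finsupp.single (i, j) 1 - Finsupp.single (i', j') 1, ?_⟩
      ext z
      have hx' := Finsupp.mem_support_iff.1 hx
      have hy' := Finsupp.mem_support_iff.1 hy
      have : (i, j) ≠ (i', j') := fun h => hi.ne (congrArg Prod.fst h)
      simp only [Finsupp.add_apply, Finsupp.tsub_apply, Finsupp.single_apply]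
      grind
    have h1 := hgen m₀ _ hmem
    have h2 := hstep (m₀ + Finsupp.single (i, j') 1 + Finsupp.single (i', j) 1)
      (by simpa using hm) (by
        simp only [map_add, Finsupp.weight_single, smul_eq_mul, one_mul]
        rw [Fin.lt_def] at hi hj
        nlinarith)
    convert L.add_mem h1 h2 using 1
    simp only [monomial_add_single, pow_one]
    ring
  by_cases h1 : ∀ x ∈ m.support, (x.1 : ℕ) < n₂ - n₁ → (x.2 : ℕ) < n₁
  swap
  · push Not at h1
    obtain ⟨⟨i, j⟩, hx, hi, hj⟩ := h1
    obtain ⟨m₀, rfl⟩ := exists_add_of_le (hle _ hx)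
    have := hgen m₀ (X (i, j))
      (Ideal.subset_span (Or.inl (Or.inl (Or.inl ⟨i, j, hi, hj, rfl⟩))))
    rwa [← pow_one (X (i, j)), ← monomial_add_single, add_comm] at this
  by_cases h2 : ∀ x ∈ m.support, ∀ y ∈ m.support, x.1 < y.1 → x.2 < y.2 →
      n₂ - n₁ ≤ (y.1 : ℕ) ∧ (x.2 : ℕ) < n₁
  swap
  · push Not at h2
    obtain ⟨⟨i, j⟩, hx, ⟨i', j'⟩, hy, hi, hj, h⟩ := h2
    refine hpair _ hx _ hy hi hj (Ideal.subset_span (Or.inl ?_))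
    by_cases hi' : (i' : ℕ) < n₂ - n₁
    · exact Or.inl (Or.inr ⟨i, i', j, j', hi, hi', hj, h1 _ hy hi', rfl⟩)
    · have hj' := h (not_lt.1 hi')
      refine Or.inr ⟨i, i', j, j', ?_, hi, hj', hj, rfl⟩
      by_contra! hlt
      exact absurd (h1 _ hx hlt) (not_lt.2 hj')
  obtain ⟨⟨i₁, j₁⟩, hx, ⟨i₂, j₂⟩, hy, ⟨i₃, j₃⟩, hz, hi, hj, hi', hj'⟩ :
      ∃ x ∈ m.support, ∃ y ∈ m.support, ∃ z ∈ m.support,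
        x.1 < y.1 ∧ x.2 < y.2 ∧ y.1 < z.1 ∧ y.2 < z.2 := by
    by_contra! h3
    exact hstd ⟨h1, h2, fun x hx y hy z hz a b c d => absurd d (not_lt.2 (h3 x hx y hy z hz a b c))⟩
  obtain ⟨m₀, rfl⟩ : ∃ m₀, m = m₀ + Finsupp.single (i₁, j₁) 1 + Finsupp.single (i₂, j₂) 1 +
      Finsupp.single (i₃, j₃) 1 := by
    refine ⟨m - Finsupp.single (i₁, j₁) 1 - Finsupp.single (i₂, j₂) 1 -
      Finsupp.single (i₃, j₃) 1, ?_⟩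
    ext z
    have hx' := Finsupp.mem_support_iff.1 hx
    have hy' := Finsupp.mem_support_iff.1 hy
    have hz' := Finsupp.mem_support_iff.1 hz
    have h12 : (i₁, j₁) ≠ (i₂, j₂) := fun h => hi.ne (congrArg Prod.fst h)
    have h23 : (i₂, j₂) ≠ (i₃, j₃) := fun h => hi'.ne (congrArg Prod.fst h)
    have h13 : (i₁, j₁) ≠ (i₃, j₃) := fun h => (hi.trans hi').ne (congrArg Prod.fst h)
    simp only [Finsupp.add_apply, Finsupp.tsub_apply, Finsupp.single_apply]
    grind
  have hmem := hgen m₀ _ (Ideal.subset_span (Or.inr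
    ⟨i₁, i₂, i₃, j₁, j₂, j₃, hi, hi', hj, hj', rfl⟩))
  rw [Fin.lt_def] at hi hi' hj hj'
  have hperm : ∀ x y z : Fin (n - n₁) × Fin n₂,
      (x.1 : ℕ) * x.2 + y.1 * y.2 + z.1 * z.2 < i₁ * j₁ + i₂ * j₂ + i₃ * j₃ →
      monomial (m₀ + Finsupp.single x 1 + Finsupp.single y 1 + Finsupp.single z 1) 1 ∈ L := by
    intro x y z h
    refine hstep _ (by simpa using hm) ?_
    simp only [map_add, Finsupp.weight_single, smul_eq_mul, one_mul]
    omega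
  have e1 := hperm (i₂, j₁) (i₃, j₂) (i₁, j₃) (by dsimp only; nlinarith)
  have e2 := hperm (i₃, j₁) (i₁, j₂) (i₂, j₃) (by dsimp only; nlinarith)
  have e3 := hperm (i₂, j₁) (i₁, j₂) (i₃, j₃) (by dsimp only; nlinarith)
  have e4 := hperm (i₁, j₁) (i₃, j₂) (i₂, j₃) (by dsimp only; nlinarith)
  have e5 := hperm (i₃, j₁) (i₂, j₂) (i₁, j₃) (by dsimp only; nlinarith)
  convert L.add_mem hmem (L.sub_mem (L.add_mem (L.add_mem e3 e4) e5) (L.add_mem e1 e2)) using 1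
  simp only [monomial_add_single, pow_one]
  ring

open MvPolynomial in
theorem hilbFn_eq_card_standardExponent (F : Type*) [Field F] (k : ℕ) :
    hilbFn F n n₁ n₂ k = Nat.card (StandardExponent (n - n₁) n₂ (n₂ - n₁) n₁ k) := by
  classical
  set J := Submodule.comap (homogeneousSubmodule (Fin (n - n₁) × Fin n₂) F k).subtype
    ((detIdeal F n n₁ n₂).restrictScalars F) with hJ
  let e : StandardExponent (n - n₁) n₂ (n₂ - n₁) n₁ k →
      homogeneousSubmodule (Fin (n - n₁) × Fin n₂) F k :=
    fun m => ⟨monomial m.1 1, isHomogeneous_monomial _ m.2.1⟩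
  have hli : LinearIndependent F (J.mkQ ∘ e) := by
    rw [linearIndependent_iff]
    intro l hl
    rw [← Finsupp.apply_linearCombination, Submodule.mkQ_apply, Submodule.Quotient.mk_eq_zero, hJ,
      Submodule.mem_comap] at hl
    have hcoe : (homogeneousSubmodule (Fin (n - n₁) × Fin n₂) F k).subtype
        (Finsupp.linearCombination F e l) = l.sum fun m r => monomial m.1 r := by
      rw [Finsupp.apply_linearCombination, Finsupp.linearCombination_apply]
      refine Finsupp.sum_congr fun m _ => ?_
      simp [e, smul_monomial]
    have hcoeff : ∀ m, coeff m (l.sum fun m r => monomial m.1 r) =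
        if h : m.degree = k ∧ IsStandard (n₂ - n₁) n₁ m.support then l ⟨m, h⟩ else 0 := by
      intro m
      rw [Finsupp.sum, coeff_sum]
      simp only [coeff_monomial]
      split_ifs with h
      · rw [Finset.sum_eq_single ⟨m, h⟩]
        · simp
        · intro m' _ hne
          exact if_neg fun h' => hne (Subtype.ext h')
        · simp
      · refine Finset.sum_eq_zero fun m' _ => if_neg ?_
        rintro rfl
        exact h m'.2
    have hzero : (l.sum fun m r => monomial m.1 r) = 0 := by
      refine eq_zero_of_parametrization_eq_zero (a := n₂ - n₁) (c := n₁)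
        (detIdeal_le_ker F (by rwa [hcoe] at hl)) fun m hm => ?_
      by_contra hstd
      rw [mem_support_iff, hcoeff, dif_neg fun h => hstd h.2] at hm
      exact hm rfl
    ext m
    have := hcoeff m.1
    rw [hzero, dif_pos m.2] at this
    simpa using this.symm
  have hspan : ⊤ ≤ Submodule.span F (Set.range (J.mkQ ∘ e)) := by
    rintro q -
    obtain ⟨⟨f, hf⟩, rfl⟩ := J.mkQ_surjective q
    have hmem : f ∈ Submodule.span F (Set.range fun m : StandardExponent (n - n₁) n₂ (n₂ - n₁) n₁ k =>
        (monomial m.1 1 : MvPolynomial (Fin (n - n₁) × Fin n₂) F)) ⊔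
        (detIdeal F n n₁ n₂).restrictScalars F := by
      rw [f.as_sum]
      refine Submodule.sum_mem _ fun m hm => ?_
      rw [← mul_one (coeff m f), ← smul_eq_mul, ← smul_monomial]
      refine Submodule.smul_mem _ _ (monomial_mem_span_sup_detIdeal ?_)
      by_contra hne
      exact mem_support_iff.1 hm (IsHomogeneous.coeff_eq_zero hf hne)
    obtain ⟨g, hg, h, hh, rfl⟩ := Submodule.mem_sup.1 hmem
    have hrange : (Set.range fun m : StandardExponent (n - n₁) n₂ (n₂ - n₁) n₁ k =>
        (monomial m.1 1 : MvPolynomial (Fin (n - n₁) × Fin n₂) F)) =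
        (homogeneousSubmodule (Fin (n - n₁) × Fin n₂) F k).subtype '' Set.range e := by
      rw [← Set.range_comp]
      rfl
    rw [hrange, Submodule.span_image] at hg
    obtain ⟨g', hg', rfl⟩ := hg
    rw [Set.range_comp, Submodule.span_image]
    refine ⟨g', hg', ?_⟩
    rw [Submodule.mkQ_apply, Submodule.mkQ_apply, eq_comm, Submodule.Quotient.eq, hJ,
      Submodule.mem_comap]
    simpa using hh
  exact Module.finrank_eq_nat_card_basis (Module.Basis.mk hli hspan)

end Hilbert

section Counting

theorem card_degree_eq_support_erase_eq {σ : Type*} [Fintype σ] [DecidableEq σ] (x₀ : σ)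
    (T : Finset σ) (hT : x₀ ∉ T) {k : ℕ} (hk : T.card ≤ k) :
    Nat.card {m : σ →₀ ℕ // m.degree = k ∧ m.support.erase x₀ = T} = k.choose T.card := by
  set u : σ →₀ ℕ := Finsupp.indicator T fun _ _ => 1 with hu
  have hu_apply : ∀ z, u z = if z ∈ T then 1 else 0 := by
    intro z
    simp [hu, Finsupp.indicator_apply]
  have hudeg : u.degree = T.card := by
    simp [Finsupp.degree_eq_sum, hu_apply]
  have hsupp : ∀ m : σ →₀ ℕ, m.support.erase x₀ = T ↔ u ≤ m ∧ (m - u).support ⊆ insert x₀ T := by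
    intro m
    simp only [Finset.ext_iff, Finset.subset_iff, Finsupp.le_def, Finset.mem_erase,
      Finsupp.mem_support_iff, Finsupp.tsub_apply, hu_apply, Finset.mem_insert]
    grind
  have e : {m : σ →₀ ℕ // m.degree = k ∧ m.support.erase x₀ = T} ≃
      (insert x₀ T).finsuppAntidiag (k - T.card) :=
    { toFun := fun m => ⟨m.1 - u, by
        obtain ⟨m, hm, hmT⟩ := m
        obtain ⟨hle, hs⟩ := (hsupp m).1 hmT
        obtain ⟨v, rfl⟩ := exists_add_of_le hle
        rw [add_tsub_cancel_left] at hs ⊢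
        rw [Finset.mem_finsuppAntidiag]
        refine ⟨?_, hs⟩
        rw [map_add, hudeg] at hm
        rw [← hm, add_tsub_cancel_left, Finsupp.degree_apply]
        exact (Finset.sum_subset hs (by simp)).symm⟩
      invFun := fun v => ⟨u + v.1, by
        obtain ⟨v, hv⟩ := v
        obtain ⟨hv, hs⟩ := Finset.mem_finsuppAntidiag.1 hv
        refine ⟨?_, (hsupp _).2 ⟨le_self_add, by rwa [add_tsub_cancel_left]⟩⟩
        rw [map_add, hudeg, Finsupp.degree_apply, Finset.sum_subset hs (by simp)]
        exact (congrArg (T.card + ·) hv).trans (Nat.add_sub_of_le hk)⟩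
      left_inv := fun m => Subtype.ext (add_tsub_cancel_of_le ((hsupp m.1).1 m.2.2).1)
      right_inv := fun v => Subtype.ext (add_tsub_cancel_left _ _) }
  rw [Nat.card_congr e, Nat.card_eq_fintype_card, Fintype.card_coe,
    Finset.card_finsuppAntidiag_nat_eq_choose, Finset.card_insert_of_notMem hT,
    show T.card + 1 + (k - T.card) - 1 = k by omega, Nat.choose_symm hk]

theorem IsStandard.erase_iff {N M a c : ℕ} {x₀ : Fin N × Fin M} (ha : a ≤ (x₀.1 : ℕ))
    (hrow : ∀ i, i ≤ x₀.1) (hcol : ∀ j, x₀.2 ≤ j) (T : Finset (Fin N × Fin M)) :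
    IsStandard a c (T.erase x₀) ↔ IsStandard a c T := by
  have key : ∀ x ∈ T, ∀ y ∈ T, x.1 < y.1 → x.2 < y.2 → x ∈ T.erase x₀ ∧ y ∈ T.erase x₀ := by
    intro x hx y hy h1 h2
    refine ⟨Finset.mem_erase.2 ⟨?_, hx⟩, Finset.mem_erase.2 ⟨?_, hy⟩⟩
    · rintro rfl
      exact absurd h1 (not_lt.2 (hrow _))
    · rintro rfl
      exact absurd h2 (not_lt.2 (hcol _))
  constructor
  · rintro ⟨h1, h2, h3⟩
    refine ⟨fun x hx hxa => h1 x (Finset.mem_erase.2 ⟨?_, hx⟩) hxa,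
      fun x hx y hy hi hj => h2 x (key x hx y hy hi hj).1 y (key x hx y hy hi hj).2 hi hj,
      fun x hx y hy z hz hi hj hi' hj' => h3 x (key x hx y hy hi hj).1 y (key x hx y hy hi hj).2 z
        (key y hy z hz hi' hj').2 hi hj hi' hj'⟩
    rintro rfl
    omega
  · rintro ⟨h1, h2, h3⟩
    have hsub := fun x (hx : x ∈ T.erase x₀) => Finset.mem_of_mem_erase hx
    exact ⟨fun x hx => h1 x (hsub x hx), fun x hx y hy => h2 x (hsub x hx) y (hsub y hy),
      fun x hx y hy z hz => h3 x (hsub x hx) y (hsub y hy) z (hsub z hz)⟩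

open Classical in
theorem card_standardExponent {N M a c k : ℕ} {x₀ : Fin N × Fin M} (ha : a ≤ (x₀.1 : ℕ))
    (hrow : ∀ i, i ≤ x₀.1) (hcol : ∀ j, x₀.2 ≤ j) (hk : N * M ≤ k) :
    Nat.card (StandardExponent N M a c k) =
      ∑ T : Finset (Fin N × Fin M) with x₀ ∉ T ∧ IsStandard a c T, k.choose T.card := by
  have e : StandardExponent N M a c k ≃
      Σ T : {T : Finset (Fin N × Fin M) // x₀ ∉ T ∧ IsStandard a c T},
        {m : Fin N × Fin M →₀ ℕ // m.degree = k ∧ m.support.erase x₀ = T.1} :=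
    { toFun := fun m => ⟨⟨m.1.support.erase x₀, Finset.notMem_erase _ _,
        (IsStandard.erase_iff ha hrow hcol _).2 m.2.2⟩, ⟨m.1, m.2.1, rfl⟩⟩
      invFun := fun p => ⟨p.2.1, p.2.2.1,
        (IsStandard.erase_iff ha hrow hcol _).1 (p.2.2.2.symm ▸ p.1.2.2)⟩
      left_inv := fun m => rfl
      right_inv := fun p => Sigma.subtype_ext (Subtype.ext p.2.2.2) rfl }
  have hfin : ∀ T : {T : Finset (Fin N × Fin M) // x₀ ∉ T ∧ IsStandard a c T},
      Finite {m : Fin N × Fin M →₀ ℕ // m.degree = k ∧ m.support.erase x₀ = T.1} := fun T =>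
    Set.Finite.subset (Finsupp.finite_of_degree_eq k) fun m hm => hm.1
  rw [Nat.card_congr e, Nat.card_sigma, Finset.sum_subtype (p := fun T => x₀ ∉ T ∧ IsStandard a c T)
    _ (by simp)]
  refine Finset.sum_congr rfl fun T _ => card_degree_eq_support_erase_eq x₀ T.1 T.2.1 ?_
  exact (Finset.card_le_univ _).trans (by simpa using hk)

end Counting

theorem arithmeticGenus_eq_one {F : Type*} [Field F] [CharZero F] (n n₁ n₂ : ℕ)
    (h1 : 1 ≤ n₁) (h2 : n₁ ≤ n₂) (h3 : n₂ < n) :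
    ∃ p : Polynomial ℚ,
      (∀ᶠ k in Filter.atTop, (hilbFn F n n₁ n₂ k : ℚ) = p.eval (k : ℚ)) ∧
      p.coeff 0 = 1 := by
  classical
  let x₀ : Fin (n - n₁) × Fin n₂ := (⟨n - n₁ - 1, by omega⟩, ⟨0, by omega⟩)
  let s : Finset (Finset (Fin (n - n₁) × Fin n₂)) :=
    Finset.univ.filter fun T => x₀ ∉ T ∧ IsStandard (n₂ - n₁) n₁ T
  refine ⟨∑ T ∈ s, Polynomial.C ((T.card.factorial : ℚ)⁻¹) * descPochhammer ℚ T.card, ?_, ?_⟩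
  · filter_upwards [Filter.eventually_ge_atTop ((n - n₁) * n₂)] with k hk
    have hcard := card_standardExponent (a := n₂ - n₁) (c := n₁) (x₀ := x₀)
      (show n₂ - n₁ ≤ n - n₁ - 1 by omega)
      (fun i => Fin.le_def.2 (show (i : ℕ) ≤ n - n₁ - 1 by omega))
      (fun j => Fin.le_def.2 (Nat.zero_le _)) hk
    rw [hilbFn_eq_card_standardExponent, hcard, Nat.cast_sum, Polynomial.eval_finsetSum]
    refine Finset.sum_congr (by ext; simp [s]) fun T _ => ?_
    rw [Nat.cast_choose_eq_descPochhammer_div, Polynomial.eval_mul, Polynomial.eval_C]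
    ring
  · rw [Polynomial.coeff_zero_eq_eval_zero, Polynomial.eval_finsetSum,
      Finset.sum_eq_single (∅ : Finset (Fin (n - n₁) × Fin n₂))]
    · simp
    · intro T _ hT
      rw [Polynomial.eval_mul, descPochhammer_ne_zero_eval_zero ℚ (Finset.card_ne_zero.2
        (Finset.nonempty_iff_ne_empty.2 hT)), mul_zero]
    · intro h
      exact absurd (by simp [s, IsStandard]) h
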